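/- The class of nice graphs is not closed under complementation: there exists a finite simple graph G such that G is nice and the complement of G is not nice. -/

import Mathlib

open SimpleGraph

/-- The chromatic number of a graph, as a natural number. -/
noncomputable def chi {V : Type*} (G : SimpleGraph V) : ℕ :=
  sInf {n | G.Colorable n}

/-- The independence (stability) number of a graph. -/
noncomputable def indepNum {V : Type*} (G : SimpleGraph V) : ℕ :=
  sSup {n | ∃ s : Finset V, s.card = n ∧ ∀ a ∈ s, ∀ b ∈ s, ¬ G.Adj a b}

/-- A graph is perfect if every induced subgraph has chromatic number equal to
its clique number. -/
def IsPerfect {V : Type*} (G : SimpleGraph V) : Prop :=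
  ∀ s : Set V, chi (G.induce s) = (G.induce s).cliqueNum

/-- A graph is nice if every induced subgraph `H` satisfies `χ(H) - ω(H) ∈ {0, 1}`. -/
def IsNice {V : Type*} (G : SimpleGraph V) : Prop :=
  ∀ s : Set V, chi (G.induce s) = (G.induce s).cliqueNum ∨
    chi (G.induce s) = (G.induce s).cliqueNum + 1

/-- The perfect chromatic number: the smallest `k` such that the vertex set can be
partitioned into `k` perfect sets. -/
noncomputable def chiP {V : Type*} (G : SimpleGraph V) : ℕ :=
  sInf {k | ∃ f : V → Fin k, ∀ i, IsPerfect (G.induce (f ⁻¹' {i}))}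

theorem chi_le_of_colorable {V : Type*} {G : SimpleGraph V} {n : ℕ} (h : G.Colorable n) :
    chi G ≤ n :=
  Nat.sInf_le h

theorem colorable_chi {V : Type*} [Finite V] (G : SimpleGraph V) : G.Colorable (chi G) :=
  have := Fintype.ofFinite V
  Nat.sInf_mem (s := {n | G.Colorable n}) ⟨_, G.colorable_of_fintype⟩

theorem cliqueNum_le_chi {V : Type*} [Finite V] (G : SimpleGraph V) : G.cliqueNum ≤ chi G := by
  obtain ⟨s, hs⟩ := G.exists_isNClique_cliqueNum
  exact hs.card_eq ▸ hs.isClique.card_le_of_colorable (colorable_chi G)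

theorem chi_le_cliqueNum_add_one {V : Type*} [Finite V] {G : SimpleGraph V}
    (h : G.Colorable 3) : chi G ≤ G.cliqueNum + 1 := by
  classical
  by_cases hG : G = ⊥
  · have : G.Colorable 1 := ⟨Coloring.mk (fun _ => 0) (by simp [hG])⟩
    exact (chi_le_of_colorable this).trans (by omega)
  · obtain ⟨u, v, huv⟩ := ne_bot_iff_exists_adj.mp hG
    have hc : G.IsClique ({u, v} : Finset V) := by
      simpa using (isClique_pair (G := G)).mpr fun _ => huv
    have h2 := hc.card_le_cliqueNum
    rw [Finset.card_pair huv.ne] at h2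
    exact (chi_le_of_colorable h).trans (by omega)

theorem isNice_of_colorable_three {V : Type*} [Finite V] {G : SimpleGraph V}
    (h : G.Colorable 3) : IsNice G := by
  intro s
  have h1 := cliqueNum_le_chi (G.induce s)
  have h2 := chi_le_cliqueNum_add_one (G := G.induce s)
    (h.of_hom (Embedding.induce s).toHom)
  omega

theorem IsNice.chi_le {V : Type*} [Finite V] {G : SimpleGraph V} (h : IsNice G) :
    chi G ≤ G.cliqueNum + 1 := by
  have h1 := G.cliqueNum_induce_le Set.univ
  have h2 : chi G ≤ chi (G.induce Set.univ) :=
    chi_le_of_colorable ((colorable_chi _).of_hom (induceUnivIso G).symm.toHom)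
  have := h Set.univ
  omega

theorem card_le_two_of_isClique_cycleGraph_five (s : Finset (Fin 5))
    (hs : ∀ x ∈ s, ∀ y ∈ s, x ≠ y → (cycleGraph 5).Adj x y) : s.card ≤ 2 := by
  revert s; decide

theorem card_le_two_of_isIndepSet_cycleGraph_five (s : Finset (Fin 5))
    (hs : ∀ x ∈ s, ∀ y ∈ s, x ≠ y → ¬ (cycleGraph 5).Adj x y) : s.card ≤ 2 := by
  revert s; decide

theorem three_le_card_image_of_cycleGraph_five_compl {α : Type*} [DecidableEq α]
    (f : Fin 5 → α) (hf : ∀ x y, x ≠ y → f x = f y → (cycleGraph 5).Adj x y) :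
    3 ≤ (Finset.univ.image f).card := by
  have := Finset.card_le_mul_card_image (f := f) Finset.univ 2 fun a _ =>
    card_le_two_of_isClique_cycleGraph_five _ fun x hx y hy hxy =>
      hf x y hxy (by simp_all)
  rw [Finset.card_univ, Fintype.card_fin] at this
  omega

theorem cliqueNum_compl_cycleGraph_five_sum_le :
    (cycleGraph 5 ⊕g cycleGraph 5)ᶜ.cliqueNum ≤ 4 := by
  obtain ⟨s, hs⟩ := (cycleGraph 5 ⊕g cycleGraph 5)ᶜ.exists_isNClique_cliqueNum
  have hl := card_le_two_of_isIndepSet_cycleGraph_five s.toLeft fun x hx y hy hxy hadj =>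
    (hs.isClique (Finset.mem_toLeft.mp hx) (Finset.mem_toLeft.mp hy) (by simpa)).2 (by simpa)
  have hr := card_le_two_of_isIndepSet_cycleGraph_five s.toRight fun x hx y hy hxy hadj =>
    (hs.isClique (Finset.mem_toRight.mp hx) (Finset.mem_toRight.mp hy) (by simpa)).2 (by simpa)
  have := s.card_toLeft_add_card_toRight
  have := hs.card_eq
  omega

theorem six_le_of_colorable_compl_cycleGraph_five_sum {n : ℕ}
    (h : (cycleGraph 5 ⊕g cycleGraph 5)ᶜ.Colorable n) : 6 ≤ n := by
  obtain ⟨C⟩ := h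
  have hC : ∀ x y, x ≠ y → C x = C y → (cycleGraph 5 ⊕g cycleGraph 5).Adj x y := by
    intro x y hxy hc
    by_contra hadj
    exact C.valid ((compl_adj _ _ _).mpr ⟨hxy, hadj⟩) hc
  have hl := three_le_card_image_of_cycleGraph_five_compl (fun x => C (Sum.inl x))
    fun x y hxy hc => by simpa using hC (Sum.inl x) (Sum.inl y) (by simpa) hc
  have hr := three_le_card_image_of_cycleGraph_five_compl (fun x => C (Sum.inr x))
    fun x y hxy hc => by simpa using hC (Sum.inr x) (Sum.inr y) (by simpa) hc
  have hd : Disjoint (Finset.univ.image fun x => C (Sum.inl x))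
      (Finset.univ.image fun x => C (Sum.inr x)) := by
    simp only [Finset.disjoint_left, Finset.mem_image, Finset.mem_univ, true_and, not_exists]
    rintro _ ⟨x, rfl⟩ y hy
    simpa using hC (Sum.inr y) (Sum.inl x) (by simp) hy
  have := Finset.card_le_univ (Finset.disjUnion _ _ hd)
  rw [Finset.card_disjUnion, Fintype.card_fin] at this
  omega

theorem colorable_three_cycleGraph_five : (cycleGraph 5).Colorable 3 :=
  chromaticNumber_le_iff_colorable.mp
    (chromaticNumber_cycleGraph_of_odd 5 (by norm_num) (by decide)).le

/-- The class of nice graphs is not closed under complementation. -/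
theorem stmt_14 :
    ∃ (V : Type) (_ : Fintype V) (G : SimpleGraph V), IsNice G ∧ ¬ IsNice Gᶜ := by
  refine ⟨Fin 5 ⊕ Fin 5, inferInstance, cycleGraph 5 ⊕g cycleGraph 5, ?_, fun h => ?_⟩
  · exact isNice_of_colorable_three
      (colorable_three_cycleGraph_five.sum_max colorable_three_cycleGraph_five)
  · have h1 := h.chi_le
    have h2 := cliqueNum_compl_cycleGraph_five_sum_le
    have h3 := six_le_of_colorable_compl_cycleGraph_five_sum (colorable_chi _)
    omega
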